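/- Let G be a unicyclic graph whose unique cycle is the odd cycle C_{2n+1} = (x_1,…,x_{2n+1}) (n ≥ 1), let I = I(G) be its edge ideal, and let l = |E(G)| − (2n+1). Then for every s ≥ 1, the number of minimal monomial generators of I^s equals the multichoose number ((2n+1+l) multichoose s) = C(2n+l+s, s). -/

import Mathlib

open MvPolynomial

noncomputable section

/-- The edge ideal of a simple graph: `I(G) = ⟨X_u · X_v : {u,v} ∈ E(G)⟩`. -/
def edgeIdeal (𝕜 : Type) [Field 𝕜] {V : Type} (G : SimpleGraph V) :
    Ideal (MvPolynomial V 𝕜) :=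
  Ideal.span {p | ∃ u v : V, G.Adj u v ∧ p = X u * X v}

/-- `G` is a unicyclic graph (connected with exactly one cycle, equivalently connected with as
many edges as vertices) whose unique cycle is the odd cycle `C_{2n+1}` on the vertices `x j`. -/
structure IsUnicyclicOddCycle {V : Type} [Fintype V] (G : SimpleGraph V) (n : ℕ)
    (x : ZMod (2 * n + 1) → V) : Prop where
  connected : G.Connected
  edge_count : G.edgeSet.ncard = Fintype.card V
  inj : Function.Injective x
  adj_iff : ∀ i j : ZMod (2 * n + 1), G.Adj (x i) (x j) ↔ (j = i + 1 ∨ i = j + 1)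

/-- `f` is a minimal monomial generator of the monomial ideal `J`: it is a monic monomial
belonging to `J` such that no monic monomial of `J` properly divides it. -/
def IsMinMonomialGen {𝕜 : Type} [Field 𝕜] {V : Type} (J : Ideal (MvPolynomial V 𝕜))
    (f : MvPolynomial V 𝕜) : Prop :=
  (∃ m : V →₀ ℕ, f = monomial m 1) ∧ f ∈ J ∧
    ∀ g : MvPolynomial V 𝕜, (∃ m : V →₀ ℕ, g = monomial m 1) → g ∈ J → g ∣ f → g = f

/-- The exponent vector of an edge. -/
def edgeExp {V : Type} (e : Sym2 V) : V →₀ ℕ :=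
  Sym2.lift ⟨fun u v => Finsupp.single u 1 + Finsupp.single v 1, fun _ _ => add_comm _ _⟩ e

theorem edgeExp_mk {V : Type} (u v : V) :
    edgeExp s(u, v) = Finsupp.single u 1 + Finsupp.single v 1 := rfl

/-- The exponent vector of a multiset of edges. -/
def multiExp {V : Type} {G : SimpleGraph V} (T : Multiset G.edgeSet) : V →₀ ℕ :=
  (T.map (fun e => edgeExp e.1)).sum

/-- The exponents of products of `s` edges. -/
def expSet {V : Type} (G : SimpleGraph V) (s : ℕ) : Set (V →₀ ℕ) :=
  Set.range (fun T : Sym G.edgeSet s => multiExp (T : Multiset G.edgeSet))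

theorem edgeExp_degree {V : Type} (e : Sym2 V) : (edgeExp e).degree = 2 := by
  induction e with
  | _ u v => rw [edgeExp_mk]; simp

theorem multiExp_degree {V : Type} {G : SimpleGraph V} (T : Multiset G.edgeSet) :
    (multiExp T).degree = 2 * T.card := by
  induction T using Multiset.induction with
  | empty => simp [multiExp]
  | cons a T ih =>
    simp only [multiExp, Multiset.map_cons, Multiset.sum_cons, map_add, Multiset.card_cons,
      edgeExp_degree] at ih ⊢
    omega

theorem multiExp_cons {V : Type} {G : SimpleGraph V} {s : ℕ} (e : G.edgeSet)
    (T : Sym G.edgeSet s) :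
    multiExp ((e ::ₛ T : Sym G.edgeSet (s + 1)) : Multiset G.edgeSet) =
      multiExp (T : Multiset G.edgeSet) + edgeExp e.1 := by
  have : ((e ::ₛ T : Sym G.edgeSet (s + 1)) : Multiset G.edgeSet) =
    e ::ₘ (T : Multiset G.edgeSet) := rfl
  rw [this, multiExp, Multiset.map_cons, Multiset.sum_cons, add_comm, multiExp]

theorem edgeIdeal_eq {V : Type} (𝕜 : Type) [Field 𝕜] (G : SimpleGraph V) :
    edgeIdeal 𝕜 G = Ideal.span (Set.range (fun e : G.edgeSet => monomial (edgeExp e.1) (1 : 𝕜))) := by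
  unfold edgeIdeal
  congr 1
  ext p
  constructor
  · rintro ⟨u, v, h, rfl⟩
    exact ⟨⟨s(u, v), h⟩, by simp [edgeExp_mk, X, monomial_mul]⟩
  · rintro ⟨⟨e, he⟩, rfl⟩
    induction e with
    | _ u v => exact ⟨u, v, he, by simp [edgeExp_mk, X, monomial_mul]⟩

theorem edgeIdeal_pow {V : Type} (𝕜 : Type) [Field 𝕜] (G : SimpleGraph V) (s : ℕ) :
    edgeIdeal 𝕜 G ^ s = Ideal.span ((fun m => monomial m (1 : 𝕜)) '' expSet G s) := by
  induction s with
  | zero =>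
    rw [pow_zero, Ideal.one_eq_top, eq_comm, Ideal.eq_top_iff_one]
    apply Ideal.subset_span
    exact ⟨0, ⟨Sym.nil, by simp [multiExp]⟩, by simp⟩
  | succ s ih =>
    rw [pow_succ, ih, edgeIdeal_eq, Ideal.span_mul_span']
    congr 1
    ext p
    rw [Set.mem_mul]
    constructor
    · rintro ⟨_, ⟨_, ⟨T, rfl⟩, rfl⟩, _, ⟨e, rfl⟩, rfl⟩
      refine ⟨_, ⟨e ::ₛ T, rfl⟩, ?_⟩
      simp [multiExp_cons, monomial_mul]
    · rintro ⟨_, ⟨T, rfl⟩, rfl⟩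
      obtain ⟨e, T, rfl⟩ := T.exists_eq_cons_of_succ
      refine ⟨_, ⟨_, ⟨T, rfl⟩, rfl⟩, _, ⟨e, rfl⟩, ?_⟩
      simp [multiExp_cons, monomial_mul]

theorem isMin_iff {V : Type} (𝕜 : Type) [Field 𝕜] (G : SimpleGraph V) (s : ℕ) :
    {f : MvPolynomial V 𝕜 | IsMinMonomialGen ((edgeIdeal 𝕜 G) ^ s) f} =
      (fun m => monomial m (1 : 𝕜)) '' expSet G s := by
  classical
  have key : ∀ m : V →₀ ℕ, monomial m (1 : 𝕜) ∈ edgeIdeal 𝕜 G ^ s ↔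
      ∃ a ∈ expSet G s, a ≤ m := by
    intro m
    rw [edgeIdeal_pow, mem_ideal_span_monomial_image]
    simp [support_monomial]
  have hdeg : ∀ a ∈ expSet G s, a.degree = 2 * s := by
    rintro _ ⟨T, rfl⟩
    simp [multiExp_degree]
  have hmin : ∀ a ∈ expSet G s, ∀ b ∈ expSet G s, a ≤ b → a = b := by
    intro a ha b hb hab
    obtain ⟨c, rfl⟩ := exists_add_of_le hab
    have h1 := hdeg _ ha
    have h2 := hdeg _ hb
    rw [map_add] at h2
    have : c.degree = 0 := by omega
    rw [Finsupp.degree_eq_zero_iff] at this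
    simp [this]
  ext f
  constructor
  · rintro ⟨⟨m, rfl⟩, hm, h⟩
    obtain ⟨a, ha, ham⟩ := (key m).1 hm
    exact ⟨a, ha, h _ ⟨a, rfl⟩ ((key a).2 ⟨a, ha, le_rfl⟩)
      (monomial_dvd_monomial.2 ⟨Or.inr ham, dvd_rfl⟩)⟩
  · rintro ⟨a, ha, rfl⟩
    refine ⟨⟨a, rfl⟩, (key a).2 ⟨a, ha, le_rfl⟩, ?_⟩
    rintro _ ⟨m, rfl⟩ hm hd
    obtain ⟨b, hb, hbm⟩ := (key m).1 hm
    have hma : m ≤ a := by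
      rcases (monomial_dvd_monomial.1 hd).1 with h | h
      · exact absurd h one_ne_zero
      · exact h
    have := hmin b hb a ha (hbm.trans hma)
    subst this
    rw [le_antisymm hma hbm]

/-- The pairing of a weight function on vertices with exponent vectors. -/
def wt {V : Type} [Fintype V] (f : V → ℚ) (m : V →₀ ℕ) : ℚ := ∑ v, (m v : ℚ) * f v

theorem wt_add {V : Type} [Fintype V] (f : V → ℚ) (m m' : V →₀ ℕ) :
    wt f (m + m') = wt f m + wt f m' := by
  simp [wt, add_mul, Finset.sum_add_distrib]

theorem wt_edge {V : Type} [Fintype V] (f : V → ℚ) (u v : V) :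
    wt f (edgeExp s(u, v)) = f u + f v := by
  classical
  rw [edgeExp_mk, wt_add]
  simp [wt, Finsupp.single_apply]

theorem wt_multi {V : Type} [Fintype V] {G : SimpleGraph V} (f : V → ℚ)
    (T : Multiset G.edgeSet) :
    wt f (multiExp T) = (T.map (fun e => wt f (edgeExp e.1))).sum := by
  induction T using Multiset.induction with
  | empty => simp [multiExp, wt]
  | cons a T ih =>
    have : multiExp (a ::ₘ T) = edgeExp a.1 + multiExp T := by simp [multiExp]
    rw [this, wt_add, ih]
    simp

/-- The transpose of the incidence matrix as a linear map. -/
def incL {V : Type} [Fintype V] (G : SimpleGraph V) : (V → ℚ) →ₗ[ℚ] (G.edgeSet → ℚ) where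
  toFun f e := wt f (edgeExp e.1)
  map_add' f g := by
    ext e
    simp [wt, mul_add, Finset.sum_add_distrib]
  map_smul' c f := by
    ext e
    simp only [wt, Pi.smul_apply, smul_eq_mul, RingHom.id_apply, Finset.mul_sum]
    exact Finset.sum_congr rfl fun _ _ => by ring

theorem incL_injective {V : Type} [Fintype V] (G : SimpleGraph V) (n : ℕ)
    (x : ZMod (2 * n + 1) → V) (hx : IsUnicyclicOddCycle G n x) :
    Function.Injective (incL G) := by
  rw [injective_iff_map_eq_zero]
  intro f hf
  have hadj : ∀ u v, G.Adj u v → f v = - f u := by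
    intro u v h
    have := congrFun hf ⟨s(u, v), h⟩
    change wt f (edgeExp s(u, v)) = 0 at this
    rw [wt_edge] at this
    linarith
  have hpow : ∀ k : ℕ, f (x (k : ZMod (2 * n + 1))) = (-1) ^ k * f (x 0) := by
    intro k
    induction k with
    | zero => simp
    | succ k ih =>
      rw [hadj (x k) (x ((k + 1 : ℕ))) ((hx.adj_iff _ _).2 (Or.inl (by push_cast; rfl))), ih]
      ring
  have h0 : f (x 0) = 0 := by
    have := hpow (2 * n + 1)
    rw [ZMod.natCast_self, pow_succ, pow_mul] at this
    norm_num at this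
    linarith
  ext v
  obtain ⟨w⟩ := hx.connected.preconnected (x 0) v
  have : ∀ a b : V, G.Walk a b → f a = 0 → f b = 0 := by
    intro a b w
    induction w with
    | nil => exact id
    | cons h _ ih =>
      intro ha
      exact ih (by rw [hadj _ _ h, ha, neg_zero])
  exact this _ _ w h0

theorem multiExp_injective {V : Type} [Fintype V] (G : SimpleGraph V) (n : ℕ)
    (x : ZMod (2 * n + 1) → V) (hx : IsUnicyclicOddCycle G n x) :
    Function.Injective (multiExp : Multiset G.edgeSet → (V →₀ ℕ)) := by
  classical
  have hsurj : Function.Surjective (incL G) := by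
    rw [← LinearMap.injective_iff_surjective_of_finrank_eq_finrank]
    · exact incL_injective G n x hx
    · rw [Module.finrank_fintype_fun_eq_card, Module.finrank_fintype_fun_eq_card, ← hx.edge_count,
        ← Nat.card_coe_set_eq, Nat.card_eq_fintype_card]
  intro S T h
  ext e
  obtain ⟨f, hf⟩ := hsurj (Pi.single e 1)
  have key : ∀ T : Multiset G.edgeSet, wt f (multiExp T) = (T.count e : ℚ) := by
    intro T
    have h1 : (fun e' : G.edgeSet => wt f (edgeExp e'.1)) = Pi.single e 1 := hf
    rw [wt_multi, h1]
    induction T using Multiset.induction with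
    | empty => simp
    | cons a T ih =>
      rw [Multiset.map_cons, Multiset.sum_cons, ih, Multiset.count_cons, Pi.single_apply]
      by_cases hae : a = e
      · simp [hae, add_comm]
      · simp [hae, Ne.symm hae]
  have := key S
  rw [h, key T] at this
  exact_mod_cast this.symm

/-- the number of minimal monomial generators of `I(G)^s` for a unicyclic graph
`G` with unique odd cycle `C_{2n+1}` and `l = |E(G)| - (2n+1)` is
`((2n+1+l) multichoose s) = C(2n+l+s, s)`. -/
theorem unicyclic_power_num_min_gens {V : Type} [Fintype V] (𝕜 : Type) [Field 𝕜]
    (G : SimpleGraph V) (n : ℕ) (hn : 1 ≤ n)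
    (x : ZMod (2 * n + 1) → V) (hx : IsUnicyclicOddCycle G n x)
    (l : ℕ) (hl : l = G.edgeSet.ncard - (2 * n + 1))
    (s : ℕ) (hs : 1 ≤ s) :
    {f : MvPolynomial V 𝕜 | IsMinMonomialGen ((edgeIdeal 𝕜 G) ^ s) f}.ncard =
      Nat.choose (2 * n + l + s) s := by
  classical
  have hle : 2 * n + 1 ≤ G.edgeSet.ncard := by
    rw [hx.edge_count]
    have := Fintype.card_le_of_injective x hx.inj
    rwa [ZMod.card] at this
  rw [isMin_iff, Set.ncard_image_of_injective _ (monomial_left_injective one_ne_zero), expSet,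
    ← Nat.card_coe_set_eq, Nat.card_range_of_injective, Sym.natCard_sym_eq_choose,
    Nat.card_coe_set_eq]
  · congr 1
    omega
  · intro S T h
    exact Sym.coe_injective (multiExp_injective G n x hx h)

end
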